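/- Let a, b, r be real numbers with a > b > r > 0, and let G(x,y,a,b,r) be the degree-twelve polynomial defined in the context. Then the two points S1 = (0, sqrt((a^2 - b^2)*(b^2 - r^2))/b) and S2 = (0, -sqrt((a^2 - b^2)*(b^2 - r^2))/b) lie on the variety V(G) and are critical points of G as a function of (x,y): at each of these two points G = 0, ∂G/∂x = 0 and ∂G/∂y = 0, where the partial derivatives are taken with respect to x and y with a, b, r held fixed. -/

import Mathlib

set_option maxHeartbeats 2000000
set_option maxRecDepth 100000

/-- The degree-twelve polynomial defining the parallel lines to the ellipse
b^2*y^2 + a^2*x^2 = a^2*b^2 at offset r. -/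
noncomputable def GEll (x y a b r : ℝ) : ℝ :=
  6*b^4*x^4*a^4 - 4*y^6*b^4*a^2 - 6*a^6*x^4*b^2 - 4*b^6*x^2*a^4 + 6*b^4*x^2*a^6 + a^4*b^8 -
    2*y^2*b^8*a^2 + 6*y^2*b^6*x^2*a^2 + 6*a^6*y^2*x^2*b^2 - 10*b^4*x^2*a^4*y^2 + y^8*b^4 +
    b^8*r^4 + b^4*r^8 - 2*b^6*r^6 - 2*b^4*y^2*x^4*r^2 - 6*x^2*y^4*b^4*r^2 + 6*x^2*b^4*r^4*y^2 -
    4*b^4*y^6*r^2 + 2*b^4*y^6*x^2 + y^4*b^4*x^4 + b^4*x^4*r^4 - 2*b^4*r^6*x^2 - 2*b^6*x^2*r^4 +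
    6*y^4*b^4*r^4 - 2*b^8*y^2*r^2 + 6*b^6*r^4*y^2 - 4*b^4*r^6*y^2 + 6*a^4*y^2*b^6 +
    6*a^6*y^2*b^2*r^2 + 2*a^4*b^2*x^4*y^2 - 4*a^4*x^6*b^2 + 4*a^6*x^2*b^2*r^2 -
    8*b^4*x^2*a^4*r^2 + 10*a^4*x^4*b^2*r^2 - 6*b^4*r^2*a^2*x^2*y^2 - 6*a^4*x^2*b^2*r^2*y^2 -
    8*a^4*x^2*b^2*r^4 - 6*b^4*r^2*a^2*x^4 + 4*b^4*r^4*a^2*x^2 - 6*y^4*a^4*b^2*x^2 -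
    6*b^4*x^4*a^2*y^2 + 6*b^6*x^2*r^2*a^2 + 2*b^4*x^2*y^4*a^2 + 10*b^4*y^4*a^2*r^2 +
    4*b^6*y^2*r^2*a^2 - 8*b^4*y^2*r^4*a^2 - 8*b^4*y^2*a^4*r^2 + 2*r^6*a^2*b^4 + a^8*b^4 -
    6*a^4*y^4*r^2*b^2 + 4*a^4*y^2*r^4*b^2 - 2*a^8*b^2*x^2 + x^4*a^4*y^4 + 4*x^2*b^6*y^2*r^2 -
    6*y^4*b^6*a^2 - 4*a^6*y^2*b^4 - 2*y^4*a^4*x^2*r^2 + 2*b^2*r^2*a^2*x^4*y^2 - 2*r^8*a^2*b^2 +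
    r^8*a^4 + a^8*x^4 + a^4*x^8 - 4*a^4*x^6*r^2 + 6*a^4*x^4*r^4 + 2*b^2*r^2*a^2*x^6 -
    6*b^2*r^4*a^2*x^4 - 2*a^6*r^6 + 2*a^6*x^6 + a^8*r^4 + 2*y^6*b^2*a^2*x^2 - 2*r^6*a^4*y^2 +
    6*r^6*b^2*y^2*a^2 - 2*a^8*x^2*r^2 + y^4*a^4*r^4 - 6*y^4*b^2*r^4*a^2 - 2*a^6*y^2*r^4 +
    4*x^2*a^6*y^2*r^2 + 6*x^2*a^4*y^2*r^4 + 2*y^4*b^2*x^2*a^2*r^2 - 10*x^2*b^2*y^2*r^4*a^2 +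
    2*y^6*b^2*a^2*r^2 + 6*r^6*b^2*x^2*a^2 + 4*b^2*x^4*y^4*a^2 + 2*a^4*x^6*y^2 - 6*a^6*x^4*r^2 -
    4*r^6*a^4*x^2 + 2*b^2*x^6*a^2*y^2 + 6*r^4*a^6*x^2 - 6*a^4*x^4*r^2*y^2 + 2*b^6*y^6 -
    2*a^8*b^2*r^2 - 2*x^2*y^4*b^6 + 6*a^4*y^4*b^4 + y^4*b^8 - 6*y^4*b^6*r^2 - 2*x^4*a^6*y^2 -
    2*a^6*b^6 + 2*b^6*r^4*a^2 - 2*b^8*r^2*a^2 + 2*b^4*a^6*r^2 - 6*b^4*a^4*r^4 + 2*r^2*a^4*b^6 +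
    2*r^4*a^6*b^2 + 2*r^6*a^4*b^2

/-- On the axis `x = 0` the polynomial has a squared factor. -/
theorem GEll_axis (y a b r : ℝ) : GEll 0 y a b r =
    (b^2*y^2 - (a^2 - b^2)*(b^2 - r^2))^2 * (y^4 - 2*(a^2 + r^2)*y^2 + (a^2 - r^2)^2) := by
  unfold GEll
  ring

/-- The polynomial is even in `x`. -/
theorem GEll_even (x y a b r : ℝ) : GEll (-x) y a b r = GEll x y a b r := by
  unfold GEll
  simp only [even_two, Even.neg_pow, Even.neg_pow (show Even 4 by decide),
    Even.neg_pow (show Even 6 by decide), Even.neg_pow (show Even 8 by decide)]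

theorem GEll_deriv_x (y a b r : ℝ) : deriv (fun t : ℝ => GEll t y a b r) 0 = 0 := by
  have h := deriv_comp_neg (fun t : ℝ => GEll t y a b r) 0
  simp only [GEll_even, neg_zero] at h
  linarith

theorem GEll_deriv_y (y a b r : ℝ) (hy : b^2*y^2 - (a^2 - b^2)*(b^2 - r^2) = 0) :
    deriv (fun t : ℝ => GEll 0 t a b r) y = 0 := by
  simp only [GEll_axis]
  have h1 : DifferentiableAt ℝ (fun t : ℝ => b^2*t^2 - (a^2 - b^2)*(b^2 - r^2)) y := by fun_prop
  have h2 : DifferentiableAt ℝ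
      (fun t : ℝ => t^4 - 2*(a^2 + r^2)*t^2 + (a^2 - r^2)^2) y := by fun_prop
  have h := ((h1.hasDerivAt.pow 2).mul h2.hasDerivAt).deriv
  refine Eq.trans h ?_
  simp [hy]

theorem GEll_point (y a b r : ℝ) (hy : b^2*y^2 - (a^2 - b^2)*(b^2 - r^2) = 0) :
    GEll 0 y a b r = 0 ∧ deriv (fun t : ℝ => GEll t y a b r) 0 = 0 ∧
      deriv (fun t : ℝ => GEll 0 t a b r) y = 0 :=
  ⟨by rw [GEll_axis, hy]; ring, GEll_deriv_x y a b r, GEll_deriv_y y a b r hy⟩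

theorem ellipse_axis_singular_points (a b r : ℝ) (hab : b < a) (hbr : r < b) (hr : 0 < r) :
    (GEll 0 (Real.sqrt ((a^2 - b^2)*(b^2 - r^2))/b) a b r = 0 ∧
     deriv (fun t : ℝ => GEll t (Real.sqrt ((a^2 - b^2)*(b^2 - r^2))/b) a b r) 0 = 0 ∧
     deriv (fun t : ℝ => GEll 0 t a b r) (Real.sqrt ((a^2 - b^2)*(b^2 - r^2))/b) = 0) ∧
    (GEll 0 (-(Real.sqrt ((a^2 - b^2)*(b^2 - r^2))/b)) a b r = 0 ∧
     deriv (fun t : ℝ => GEll t (-(Real.sqrt ((a^2 - b^2)*(b^2 - r^2))/b)) a b r) 0 = 0 ∧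
     deriv (fun t : ℝ => GEll 0 t a b r) (-(Real.sqrt ((a^2 - b^2)*(b^2 - r^2))/b)) = 0) := by
  have hb : 0 < b := hr.trans hbr
  have hK : 0 ≤ (a^2 - b^2)*(b^2 - r^2) := by
    apply mul_nonneg <;> nlinarith
  have hy : b^2*(Real.sqrt ((a^2 - b^2)*(b^2 - r^2))/b)^2 - (a^2 - b^2)*(b^2 - r^2) = 0 := by
    rw [div_pow, Real.sq_sqrt hK]
    field_simp
    ring
  exact ⟨GEll_point _ a b r hy, GEll_point _ a b r (by rw [neg_sq]; exact hy)⟩
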